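/- Let F be a finite field and let n, k, s' be positive integers. The number of pairs (M, R), where for some n' ∈ {1,...,n} and k' ∈ {1,...,k} with k'/n' ≤ k/n, M ∈ F^{n'×n'} is a matrix of rank k' and sparsity s' that has nonzero diagonal entries and contains a (2s'k'/n')-sparse column basis and a (2s'k'/n')-sparse row basis, and R is a subset of {1,...,n} of size n', is at most (n · |F|)^{24 s' k / n}. -/

import Mathlib

open Matrix

/-- The sparsity of a matrix: the number of its nonzero entries. -/
noncomputable def sparsity {F : Type*} [Zero F] {m n : Type*} (M : Matrix m n F) : ℕ :=
  {p : m × n | M p.1 p.2 ≠ 0}.ncard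

/-- A square matrix `M` contains an `l`-sparse column basis if there are `M.rank` linearly
independent columns of `M` with a total of at most `l` nonzero entries. -/
def HasSparseColBasis {F : Type*} [Field F] {n : ℕ} (M : Matrix (Fin n) (Fin n) F)
    (l : ℝ) : Prop :=
  ∃ s : Finset (Fin n), s.card = M.rank ∧
    LinearIndependent F (fun j : s => Mᵀ (j : Fin n)) ∧
    ({p : Fin n × Fin n | p.2 ∈ s ∧ M p.1 p.2 ≠ 0}.ncard : ℝ) ≤ l

/-- A square matrix `M` contains an `l`-sparse row basis if there are `M.rank` linearly
independent rows of `M` with a total of at most `l` nonzero entries. -/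
def HasSparseRowBasis {F : Type*} [Field F] {n : ℕ} (M : Matrix (Fin n) (Fin n) F)
    (l : ℝ) : Prop :=
  ∃ s : Finset (Fin n), s.card = M.rank ∧
    LinearIndependent F (fun i : s => M (i : Fin n)) ∧
    ({p : Fin n × Fin n | p.1 ∈ s ∧ M p.1 p.2 ≠ 0}.ncard : ℝ) ≤ l
section SparseBasis

variable {F : Type*} {m n : ℕ}

/-- Enlarge the index range of a matrix entry. -/
def castEntry (h : m ≤ n) (t : Fin m × Fin m × F) : Fin n × Fin n × F :=
  (Fin.castLE h t.1, Fin.castLE h t.2.1, t.2.2)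

lemma castEntry_injective (h : m ≤ n) : Function.Injective (castEntry (F := F) h) := by
  rintro ⟨i, j, a⟩ ⟨i', j', a'⟩ e
  simpa [castEntry] using e

variable [Field F]

/-- The columns of `M` indexed by `J` form a basis of the column space of `M`. -/
def IsColBasis (M : Matrix (Fin m) (Fin m) F) (J : Finset (Fin m)) : Prop :=
  J.card = M.rank ∧ LinearIndependent F (fun j : J => Mᵀ (j : Fin m))

/-- The nonzero entries of `M` in the columns indexed by `J`, together with their positions. -/
def colEntries (M : Matrix (Fin m) (Fin m) F) (J : Finset (Fin m)) :
    Set (Fin m × Fin m × F) :=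
  (fun p : Fin m × Fin m => (p.1, p.2, M p.1 p.2)) '' {p | p.2 ∈ J ∧ M p.1 p.2 ≠ 0}

lemma mem_colEntries {M : Matrix (Fin m) (Fin m) F} {J : Finset (Fin m)} {i j : Fin m} {a : F} :
    (i, j, a) ∈ colEntries M J ↔ j ∈ J ∧ M i j = a ∧ a ≠ 0 := by
  simp only [colEntries, Set.mem_image, Set.mem_ofPred_eq, Prod.exists, Prod.mk.injEq]
  constructor
  · rintro ⟨i', j', ⟨hJ, h0⟩, rfl, rfl, rfl⟩
    exact ⟨hJ, rfl, h0⟩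
  · rintro ⟨hJ, rfl, h0⟩
    exact ⟨i, j, ⟨hJ, h0⟩, rfl, rfl, rfl⟩

lemma HasSparseRowBasis.transpose {M : Matrix (Fin m) (Fin m) F} {l : ℝ}
    (h : HasSparseRowBasis M l) : HasSparseColBasis Mᵀ l := by
  obtain ⟨s, hs, hli, hl⟩ := h
  refine ⟨s, by rw [hs, Matrix.rank_transpose], by simpa using hli, le_trans ?_ hl⟩
  refine Nat.cast_le.2 (le_trans (Set.ncard_le_ncard (t := Prod.swap '' _) ?_ ?_)
    (Set.ncard_image_le (f := Prod.swap) (Set.toFinite _)))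
  · rintro ⟨i, j⟩ hp
    exact ⟨(j, i), hp, rfl⟩
  · exact Set.toFinite _

lemma IsColBasis.col_mem_span {M : Matrix (Fin m) (Fin m) F} {J : Finset (Fin m)}
    (h : IsColBasis M J) (j : Fin m) :
    Mᵀ j ∈ Submodule.span F (Set.range fun j : J => Mᵀ (j : Fin m)) := by
  have hle : Submodule.span F (Set.range fun j : J => Mᵀ (j : Fin m)) ≤
      Submodule.span F (Set.range Mᵀ) := by
    refine Submodule.span_mono ?_
    rintro _ ⟨j, rfl⟩
    exact ⟨j, rfl⟩
  rw [Submodule.eq_of_le_of_finrank_eq hle]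
  · exact Submodule.subset_span ⟨j, rfl⟩
  · rw [finrank_span_eq_card h.2, Fintype.card_coe, h.1, Matrix.rank_eq_finrank_span_cols]
    rfl

lemma IsColBasis.exists_ne_zero {M : Matrix (Fin m) (Fin m) F} {J : Finset (Fin m)}
    (h : IsColBasis M J) {j : Fin m} (hj : j ∈ J) : ∃ i, M i j ≠ 0 := by
  by_contra! hz
  have h0 : Mᵀ j = 0 := funext hz
  exact h.2.ne_zero ⟨j, hj⟩ h0

/-- A linear condition that holds on a column basis holds on all columns. -/
lemma IsColBasis.forall_col {M : Matrix (Fin m) (Fin m) F} {J : Finset (Fin m)}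
    (h : IsColBasis M J) (φ : (Fin m → F) →ₗ[F] F) (hφ : ∀ j ∈ J, φ (Mᵀ j) = 0) (j : Fin m) :
    φ (Mᵀ j) = 0 := by
  have hle : Submodule.span F (Set.range fun j : J => Mᵀ (j : Fin m)) ≤ LinearMap.ker φ := by
    rw [Submodule.span_le]
    rintro _ ⟨j, rfl⟩
    exact hφ j j.2
  exact hle (h.col_mem_span j)

lemma IsColBasis.le_ncard {M : Matrix (Fin m) (Fin m) F} {J : Finset (Fin m)}
    (h : IsColBasis M J) (hd : ∀ i, M i i ≠ 0) : m ≤ (colEntries M J).ncard := by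
  have hfin : (colEntries M J).Finite := (Set.toFinite _).image _
  have himage : Prod.fst '' colEntries M J = Set.univ := by
    refine Set.eq_univ_of_forall fun i => ?_
    by_contra hi
    refine hd i (h.forall_col (LinearMap.proj i) (fun j hj => ?_) i)
    by_contra h0
    exact hi ⟨(i, j, M i j), mem_colEntries.2 ⟨hj, rfl, h0⟩, rfl⟩
  calc m = (Prod.fst '' colEntries M J).ncard := by rw [himage, Set.ncard_univ]; simp
    _ ≤ _ := Set.ncard_image_le hfin

lemma IsColBasis.eq_of_colEntries_eq {M N : Matrix (Fin m) (Fin m) F} {J K : Finset (Fin m)}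
    (hM : IsColBasis M J) (hN : IsColBasis N K) (h : colEntries M J = colEntries N K) :
    J = K ∧ ∀ i, ∀ j ∈ J, M i j = N i j := by
  have key : ∀ i j a, (j ∈ J ∧ M i j = a ∧ a ≠ 0) ↔ (j ∈ K ∧ N i j = a ∧ a ≠ 0) := by
    intro i j a
    rw [← mem_colEntries, ← mem_colEntries, h]
  have hJK : J = K := by
    ext j
    constructor
    · intro hj
      obtain ⟨i, hi⟩ := hM.exists_ne_zero hj
      exact ((key i j _).1 ⟨hj, rfl, hi⟩).1
    · intro hj
      obtain ⟨i, hi⟩ := hN.exists_ne_zero hj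
      exact ((key i j _).2 ⟨hj, rfl, hi⟩).1
  refine ⟨hJK, fun i j hj => ?_⟩
  by_cases h0 : M i j = 0
  · by_contra hne
    have := (key i j (N i j)).2 ⟨hJK ▸ hj, rfl, fun h1 => hne (h0.trans h1.symm)⟩
    exact hne this.2.1
  · exact ((key i j (M i j)).1 ⟨hj, rfl, h0⟩).2.1.symm

/-- A matrix is determined by a column basis and a row basis. -/
lemma IsColBasis.matrix_eq {M N : Matrix (Fin m) (Fin m) F} {J K I I' : Finset (Fin m)}
    (hM : IsColBasis M J) (hN : IsColBasis N K) (h : colEntries M J = colEntries N K)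
    (hM' : IsColBasis Mᵀ I) (hN' : IsColBasis Nᵀ I') (h' : colEntries Mᵀ I = colEntries Nᵀ I') :
    M = N := by
  obtain ⟨rfl, hcol⟩ := hM.eq_of_colEntries_eq hN h
  obtain ⟨rfl, hrow⟩ := hM'.eq_of_colEntries_eq hN' h'
  have hspan : ∀ A : Matrix (Fin m) (Fin m) F, IsColBasis A J → (∀ i, ∀ j ∈ J, M i j = A i j) →
      ∀ j, Aᵀ j ∈ LinearMap.range M.mulVecLin := by
    intro A hA hcol j
    refine (Submodule.span_le.2 ?_) (hA.col_mem_span j)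
    rintro _ ⟨⟨j, hj⟩, rfl⟩
    refine ⟨Pi.single j 1, ?_⟩
    ext i
    simpa using hcol i j hj
  ext i j
  obtain ⟨u, hu⟩ := Submodule.sub_mem _ (hspan M hM (fun _ _ _ => rfl) j) (hspan N hN hcol j)
  have hz := hM'.forall_col ((dotProductBilin F F).flip u) (fun i hi => ?_) i
  · have := congrFun hu i
    simp [Matrix.mulVec] at this hz
    rw [hz] at this
    exact sub_eq_zero.1 this.symm
  · have := congrFun hu i
    have hr := hrow j i hi
    simp [Matrix.mulVec] at this hr ⊢
    rw [this, hr, sub_self]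

lemma exists_range_eq_of_ncard_le {α : Type*} {S : Set α} {L : ℕ} (hS : S.Finite)
    (hne : S.Nonempty) (hL : S.ncard ≤ L) : ∃ c : Fin L → α, Set.range c = S := by
  have : Finite S := hS
  have : Nonempty S := hne.to_subtype
  have := Fintype.ofFinite S
  have hcard : Fintype.card S ≤ Fintype.card (Fin L) := by
    rwa [Fintype.card_fin, ← Nat.card_eq_fintype_card, Nat.card_coe_set_eq]
  obtain ⟨e⟩ := Function.Embedding.nonempty_of_card_le hcard
  refine ⟨fun t => (Function.invFun e t : S), ?_⟩
  rw [← Function.comp_def, Set.range_comp, (Function.invFun_surjective e.injective).range_eq]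
  simp

lemma HasSparseColBasis.exists_code {M : Matrix (Fin m) (Fin m) F} {l : ℝ} {L : ℕ}
    (h : HasSparseColBasis M l) (hd : ∀ i, M i i ≠ 0) (hm : 1 ≤ m) (hmn : m ≤ n)
    (hl : ⌊l⌋₊ ≤ L) :
    m ≤ L ∧ ∃ (c : Fin L → Fin n × Fin n × F) (J : Finset (Fin m)),
      IsColBasis M J ∧ Set.range c = castEntry hmn '' colEntries M J := by
  obtain ⟨J, hJ, hli, hs⟩ := h
  have hB : IsColBasis M J := ⟨hJ, hli⟩
  have hfin : (colEntries M J).Finite := (Set.toFinite _).image _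
  have hcard : (colEntries M J).ncard ≤ L :=
    (Set.ncard_image_le (Set.toFinite _)).trans ((Nat.le_floor hs).trans hl)
  have hlow := hB.le_ncard hd
  refine ⟨hlow.trans hcard, ?_⟩
  have hne : (colEntries M J).Nonempty := Set.nonempty_of_ncard_ne_zero (by omega)
  obtain ⟨c, hc⟩ := exists_range_eq_of_ncard_le (hfin.image (castEntry hmn)) (hne.image _)
    ((Set.ncard_image_le hfin).trans hcard)
  exact ⟨c, J, hB, hc⟩

end SparseBasis

/-- Over a finite field F, the number of pairs (M, R), where M is an n'×n' matrix
of some rank k' (1 ≤ k' ≤ k, k'/n' ≤ k/n) and sparsity s' with nonzero diagonal containing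
(2s'k'/n')-sparse column and row bases, and R ⊆ {1,...,n} with |R| = n', is at most
(n·|F|)^{24s'k/n}. -/
theorem card_pairs_sparse_basis_matrices_le (F : Type) [Field F] [Fintype F]
    (n k s' : ℕ) (hn : 0 < n) (hk : 0 < k) (hs' : 0 < s') :
    (({ p : Σ n' : ℕ, Matrix (Fin n') (Fin n') F × Finset (Fin n) |
        1 ≤ p.1 ∧ p.1 ≤ n ∧ p.2.2.card = p.1 ∧
        ∃ k' : ℕ, 1 ≤ k' ∧ k' ≤ k ∧ (k' : ℝ) / (p.1 : ℝ) ≤ (k : ℝ) / (n : ℝ) ∧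
          p.2.1.rank = k' ∧ sparsity p.2.1 = s' ∧ (∀ i, p.2.1 i i ≠ 0) ∧
          HasSparseColBasis p.2.1 ((2 * s' * k' : ℝ) / (p.1 : ℝ)) ∧
          HasSparseRowBasis p.2.1 ((2 * s' * k' : ℝ) / (p.1 : ℝ)) }.ncard : ℝ))
      ≤ ((n : ℝ) * (Fintype.card F : ℝ)) ^ ((24 * s' * k : ℝ) / (n : ℝ)) := by
  set L : ℕ := ⌊(2 * s' * k : ℝ) / n⌋₊
  set S := _
  change ((Set.ncard S : ℕ) : ℝ) ≤ _
  have hcode : ∀ p ∈ S, 1 ≤ L ∧ p.2.2.card = p.1 ∧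
      ∃ c : (Fin L → Fin n) × (Fin L → Fin n × Fin n × F) × (Fin L → Fin n × Fin n × F),
        Set.range c.1 = p.2.2 ∧ ∃ h : p.1 ≤ n,
          (∃ J, IsColBasis p.2.1 J ∧ Set.range c.2.1 = castEntry h '' colEntries p.2.1 J) ∧
          (∃ I, IsColBasis (p.2.1)ᵀ I ∧ Set.range c.2.2 = castEntry h '' colEntries (p.2.1)ᵀ I) := by
    rintro ⟨m, M, R⟩ ⟨hm, hmn, hR, k', -, -, hkk, -, -, hd, hcol, hrow⟩
    dsimp only at *
    have hl : ⌊(2 * s' * k' : ℝ) / m⌋₊ ≤ L := by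
      refine Nat.floor_le_floor ?_
      rw [mul_div_assoc, mul_div_assoc]
      gcongr
    obtain ⟨hmL, c, hc⟩ := hcol.exists_code hd hm hmn hl
    obtain ⟨-, d, hd'⟩ := hrow.transpose.exists_code (fun i => hd i) hm hmn hl
    obtain ⟨r, hr⟩ := exists_range_eq_of_ncard_le (S := (R : Set (Fin n))) (L := L)
      R.finite_toSet (Finset.coe_nonempty.2 (Finset.card_pos.1 (by omega)))
      (by rw [Set.ncard_coe_finset]; omega)
    exact ⟨hm.trans hmL, hR, (r, c, d), hr, hmn, hc, hd'⟩
  rcases S.eq_empty_or_nonempty with hS | ⟨p, hp⟩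
  · rw [hS, Set.ncard_empty, Nat.cast_zero]
    positivity
  choose hL hR f hf using hcode
  have hinj : Function.Injective fun p : S => f p.1 p.2 := by
    rintro ⟨⟨m, M, R⟩, hp⟩ ⟨⟨m', M', R'⟩, hq⟩ heq
    have h1 := hf _ hp
    have h2 := hf _ hq
    have hR1 := hR _ hp
    have hR2 := hR _ hq
    dsimp only at heq h1 h2 hR1 hR2
    rw [← heq] at h2
    obtain ⟨hr, hmn, ⟨J, hJ, hc⟩, I, hI, hd⟩ := h1
    obtain ⟨hr', hmn', ⟨J', hJ', hc'⟩, I', hI', hd'⟩ := h2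
    obtain rfl : R = R' := Finset.coe_injective (hr.symm.trans hr')
    obtain rfl : m = m' := hR1.symm.trans hR2
    obtain rfl : M = M' := hJ.matrix_eq hJ'
      ((castEntry_injective hmn).image_injective (hc.symm.trans hc')) hI hI'
      ((castEntry_injective hmn).image_injective (hd.symm.trans hd'))
    rfl
  have hcard : S.ncard ≤ n ^ L * ((n * (n * Fintype.card F)) ^ L *
      (n * (n * Fintype.card F)) ^ L) := by
    rw [← Nat.card_coe_set_eq]
    refine (Nat.card_le_card_of_injective _ hinj).trans_eq ?_
    simp [Nat.card_eq_fintype_card]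
  have hF : 1 ≤ Fintype.card F := Fintype.card_pos
  have hnat : S.ncard ≤ (n * Fintype.card F) ^ (12 * L) := by
    have h1 : n ≤ n * Fintype.card F := Nat.le_mul_of_pos_right _ hF
    have h2 : 0 < n * Fintype.card F := Nat.mul_pos hn hF
    calc S.ncard ≤ _ := hcard
      _ ≤ (n * Fintype.card F) ^ L *
          ((n * Fintype.card F * (n * Fintype.card F)) ^ L *
            (n * Fintype.card F * (n * Fintype.card F)) ^ L) := by gcongr
      _ = (n * Fintype.card F) ^ (5 * L) := by ring
      _ ≤ _ := Nat.pow_le_pow_right h2 (by omega)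
  have hbase : (1 : ℝ) ≤ (n : ℝ) * (Fintype.card F : ℝ) := by
    exact_mod_cast Nat.mul_pos hn hF
  have hLle : (L : ℝ) ≤ (2 * s' * k : ℝ) / n := Nat.floor_le (by positivity)
  calc (S.ncard : ℝ) ≤ ((n : ℝ) * (Fintype.card F : ℝ)) ^ (12 * L) := by exact_mod_cast hnat
    _ = ((n : ℝ) * (Fintype.card F : ℝ)) ^ ((12 * L : ℕ) : ℝ) := (Real.rpow_natCast _ _).symm
    _ ≤ _ := by
      refine Real.rpow_le_rpow_of_exponent_le hbase ?_
      calc ((12 * L : ℕ) : ℝ) = 12 * (L : ℝ) := by push_cast; ring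
        _ ≤ 12 * ((2 * s' * k : ℝ) / n) := by gcongr
        _ = _ := by ring
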